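/- Let G = (V, Σ, S, R) be a context-free grammar, let P be the PDA obtained from G by the CFG2PDA transformation, and let t be a quasi-tree of G with root labelled X ∈ V ∪ Σ ∪ {ε}. Then there exists a quasi-run I ⊢* I′ of P such that tape(I) = Y(t) (the yield of t), tape(I′) = ε, and the initial stack content of I is the single symbol X if X ∈ V ∪ Σ, and the fresh symbol e if X = ε. -/

import Mathlib

/-- The two-letter Dyck alphabet: `D.ab` is `ā` (the opening symbol) and `D.a` is `a`
(the closing symbol). -/
inductive D where
  | ab : D  -- ā
  | a : D   -- a
deriving DecidableEq

/-- Parse trees of the grammar `G_D = ({S}, {ā, a}, S, {S → ā S a S, S → ε})`: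
`eps` is an application of `S → ε` and `node t₁ t₂` an application of `S → ā S a S`. -/
inductive DyckTree where
  | eps : DyckTree
  | node : DyckTree → DyckTree → DyckTree

/-- The word generated by a parse tree of `G_D`. -/
def DyckTree.yield : DyckTree → List D
  | .eps => []
  | .node t₁ t₂ => D.ab :: (t₁.yield ++ D.a :: t₂.yield)

/-- The Dyck language `L_D`: the language generated by `G_D`. -/
def LD : Set (List D) := { w | ∃ t : DyckTree, t.yield = w }

/-- `Matches t i j` holds iff positions `i < j` (0-indexed) of the word `t.yield` form a
matching pair: position `i` carries `ā`, position `j` carries `a`, and the two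
corresponding leaves have the same parent in the parse tree `t`. -/
inductive Matches : DyckTree → ℕ → ℕ → Prop
  | head (t₁ t₂ : DyckTree) : Matches (.node t₁ t₂) 0 (t₁.yield.length + 1)
  | left {t₁ : DyckTree} {i j : ℕ} (t₂ : DyckTree) :
      Matches t₁ i j → Matches (.node t₁ t₂) (i + 1) (j + 1)
  | right {t₂ : DyckTree} {i j : ℕ} (t₁ : DyckTree) :
      Matches t₂ i j → Matches (.node t₁ t₂) (t₁.yield.length + 2 + i) (t₁.yield.length + 2 + j)

/-- `DelStep w v`: `v` results from `w ∈ L_D` by deleting (both positions of) one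
matching pair of `w`. -/
def DelStep (w v : List D) : Prop :=
  ∃ (t : DyckTree) (i j : ℕ), t.yield = w ∧ Matches t i j ∧
    v = (w.eraseIdx j).eraseIdx i

/-- The ordering `≼` on Dyck words: `dyckLE v w` (i.e. `v ≼ w`) holds iff `v` results
from `w` by deleting 0 or more matching pairs. -/
def dyckLE (v w : List D) : Prop := Relation.ReflTransGen DelStep w v

/-- The harmonics: `h_0 = ε` and `h_{i+1} = ā h_i a ā h_i a`. -/
def harmonicW : ℕ → List D
  | 0 => []
  | i + 1 => (D.ab :: (harmonicW i ++ [D.a])) ++ (D.ab :: (harmonicW i ++ [D.a]))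

/-- `ĥ_i = ā h_i a`. -/
def hatHarmonic (i : ℕ) : List D := D.ab :: (harmonicW i ++ [D.a])

/-- The rank of a Dyck word `w`: the greatest `q` such that `h_q ≼ w`. -/
noncomputable def rank (w : List D) : ℕ := sSup { q : ℕ | dyckLE (harmonicW q) w }

/-- Finitely-branching labelled ordered trees (used to represent quasi-trees). -/
inductive RTree (L : Type) where
  | node : L → List (RTree L) → RTree L

/-- The label of the root of a tree. -/
def RTree.label {L : Type} : RTree L → L
  | .node l _ => l

/-- The list of children of the root of a tree. -/
def RTree.children {L : Type} : RTree L → List (RTree L)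
  | .node _ ts => ts

/-- The footprint `α(n)` of a node `n` (identified with the subtree rooted at `n`):
`α(n) = a` if `n` is a leaf and `α(n) = a ā^k α(n₁) … α(n_k)` if `n` has the `k ≥ 1`
children `n₁, …, n_k` (in that order). -/
def alphaN {L : Type} : RTree L → List D
  | .node _ ts =>
      D.a :: (List.replicate ts.length D.ab ++ (ts.attach.map (fun t => alphaN t.1)).flatten)
decreasing_by
  simp only [RTree.node.sizeOf_spec]
  have := List.sizeOf_lt_of_mem t.2
  omega

/-- The footprint `α(t)` of a tree `t` with root `n`: `α(t) = ā α(n)`. -/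
def alphaT {L : Type} (t : RTree L) : List D := D.ab :: alphaN t

/-- `IsSubtree s t`: `s` is the subtree of `t` rooted at some node of `t`. -/
inductive IsSubtree {L : Type} : RTree L → RTree L → Prop
  | refl (t : RTree L) : IsSubtree t t
  | child {s c : RTree L} (t : RTree L) : c ∈ t.children → IsSubtree s c → IsSubtree s t

/-- Labels of quasi-trees of a grammar with variables `N` and terminals `T`:
`none` stands for `ε`, `some (.inl X)` for a variable `X`, `some (.inr b)` for a
terminal `b`. -/
abbrev QLbl (N T : Type) := Option (N ⊕ T)

/-- `IsQuasiTree R t`: `t` is a quasi-tree of the grammar whose rules are `R`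
(a rule `(X, w) ∈ R` stands for `X → w`): the root is labelled by some
`Z ∈ V ∪ Σ ∪ {ε}`, interior nodes are labelled by variables, leaves by terminals or by
`ε` (an `ε`-leaf being the only child of its parent), and an interior node labelled `X`
with children labelled `X₁, …, X_k` (in order) corresponds to a rule `X → X₁ … X_k`
(a rule `X → ε` corresponding to an interior node `X` whose only child is an `ε`-leaf). -/
inductive IsQuasiTree {N T : Type} (R : Set (N × List (N ⊕ T))) :
    RTree (QLbl N T) → Prop
  | leafT (b : T) : IsQuasiTree R (.node (some (.inr b)) [])
  | leafE : IsQuasiTree R (.node none [])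
  | nodeE {X : N} (h : (X, ([] : List (N ⊕ T))) ∈ R) :
      IsQuasiTree R (.node (some (.inl X)) [.node none []])
  | nodeR {X : N} {ts : List (RTree (QLbl N T))} {w : List (N ⊕ T)}
      (hne : ts ≠ []) (hrule : (X, w) ∈ R) (hlab : ts.map RTree.label = w.map some)
      (hch : ∀ t ∈ ts, IsQuasiTree R t) :
      IsQuasiTree R (.node (some (.inl X)) ts)

/-- A pushdown automaton with states `Q`, input alphabet `σ` and stack alphabet `Γ`
(the types `Q`, `σ`, `Γ` are meant to be finite, which is required where relevant):
`δ` is the set of actions, an action `(q, b, γ, p, ξ)` standing for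
`(q, b, γ) ↪ (p, ξ)` with `b ∈ Σ ∪ {ε}` encoded by `Option σ`; `q0` is the start state
and `γ0` the start stack symbol. Acceptance is by empty stack. -/
structure PDA (Q σ Γ : Type) where
  δ : Set (Q × Option σ × Γ × Q × List Γ)
  q0 : Q
  γ0 : Γ

/-- An instantaneous descriptor: state, remaining input, stack content. -/
structure ID (Q σ Γ : Type) where
  state : Q
  tape : List σ
  stack : List Γ

/-- The move relation: an action `(q, b, γ) ↪ (p, ξ′)` induces the move
`(q, b w, γ ξ) ⊢ (p, w, ξ′ ξ)`. -/
def PDA.Move {Q σ Γ : Type} (P : PDA Q σ Γ) (I I' : ID Q σ Γ) : Prop :=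
  ∃ (b : Option σ) (γ : Γ) (ξ rest : List Γ),
    (I.state, b, γ, I'.state, ξ) ∈ P.δ ∧
    I.stack = γ :: rest ∧ I'.stack = ξ ++ rest ∧
    I.tape = b.toList ++ I'.tape

/-- A quasi-run: a move sequence `I₀ ⊢ I₁ ⊢ … ⊢ I_m` such that the stack of `I₀` is a
single symbol and the stack of `I_m` is empty (represented as the list `[I₀, …, I_m]`). -/
def PDA.IsQuasiRun {Q σ Γ : Type} (P : PDA Q σ Γ) (r : List (ID Q σ Γ)) : Prop :=
  r.Chain' P.Move ∧
  (∃ (I : ID Q σ Γ) (γ : Γ), r.head? = some I ∧ I.stack = [γ]) ∧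
  (∃ I' : ID Q σ Γ, r.getLast? = some I' ∧ I'.stack = [])

/-- A run on input `w`: a quasi-run whose first ID is the initial ID `(q₀, w, γ₀)` and
whose last ID has empty tape (and, being a quasi-run, empty stack). -/
def PDA.IsRun {Q σ Γ : Type} (P : PDA Q σ Γ) (w : List σ) (r : List (ID Q σ Γ)) : Prop :=
  P.IsQuasiRun r ∧ r.head? = some ⟨P.q0, w, [P.γ0]⟩ ∧
  (∃ I' : ID Q σ Γ, r.getLast? = some I' ∧ I'.tape = [])

/-- The language of `P` (acceptance by empty stack). -/
def PDA.lang {Q σ Γ : Type} (P : PDA Q σ Γ) : Set (List σ) := { w | ∃ r, P.IsRun w r }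

/-- The footprint `α′(r)` of a quasi-run `r = I₀, …, I_m`, defined in the paper by
disassembly: `α′(r) = a` if `m = 1`, and `α′(r) = a ā^d α′(r₁) … α′(r_d)` if `m > 1`,
where `d = |stack(I₁)|` and `r₁, …, r_d` is the disassembly of `r`.  Equivalently
(unfolding the disassembly), each move `I ⊢ I'` contributes `a` (for the popped
symbol) followed by `ā^{|ξ|}` where `|ξ| = |stack(I')| + 1 − |stack(I)|` is the number
of pushed symbols; this computation is used here. -/
def alphaQR' {Q σ Γ : Type} : List (ID Q σ Γ) → List D
  | I :: I' :: rest =>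
      (D.a :: List.replicate (I'.stack.length + 1 - I.stack.length) D.ab) ++
        alphaQR' (I' :: rest)
  | _ => []

/-- The footprint `α(r) = ā α′(r)` of a quasi-run `r`. -/
def alphaQR {Q σ Γ : Type} (r : List (ID Q σ Γ)) : List D := D.ab :: alphaQR' r

/-- The oscillation of a quasi-run: `osc(r) = rank(α(r))`. -/
noncomputable def oscQR {Q σ Γ : Type} (r : List (ID Q σ Γ)) : ℕ := rank (alphaQR r)

/-- `L^(k)(P)`: the set of words accepted by some `k`-oscillating run of `P`. -/
noncomputable def PDA.oscLang {Q σ Γ : Type} (P : PDA Q σ Γ) (k : ℕ) : Set (List σ) :=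
  { w | ∃ r, P.IsRun w r ∧ oscQR r = k }

/-- A PDA is in reduced form if it has a single state (`Q = PUnit`) and each action
pops a symbol (`ξ = ε`) or pushes two symbols (`ξ ∈ Γ²`). -/
def PDA.Reduced {σ Γ : Type} (P : PDA PUnit σ Γ) : Prop :=
  ∀ a ∈ P.δ, (a.2.2.2.2 : List Γ).length = 2 ∨ a.2.2.2.2 = []

/-- For IDs `I, I'` with `stack(I) = ξ stack(I')`, `I/I' = (state(I), tape(I), ξ)`. -/
def quotID {Q σ Γ : Type} (I I' : ID Q σ Γ) : ID Q σ Γ :=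
  ⟨I.state, I.tape, I.stack.take (I.stack.length - I'.stack.length)⟩

instance {σ Γ : Type} : Inhabited (ID PUnit σ Γ) := ⟨⟨PUnit.unit, [], []⟩⟩

/-- The segment `I_s/I_e, I_{s+1}/I_e, …, I_e/I_e` of a quasi-run `r = I₀, …, I_m`,
for positions `s ≤ e`. -/
def segmentQR {σ Γ : Type} (r : List (ID PUnit σ Γ)) (s e : ℕ) : List (ID PUnit σ Γ) :=
  (List.range (e - s + 1)).map (fun j => quotID (r.getD (s + j) default) (r.getD e default))

/-- The yield of a quasi-tree: the concatenation of its leaf labels from left to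
right (an `ε`-leaf contributing nothing, a terminal leaf its terminal). -/
def yieldQ {N T : Type} : RTree (QLbl N T) → List T
  | .node (some (Sum.inr b)) [] => [b]
  | .node _ ts => (ts.attach.map (fun t => yieldQ t.1)).flatten
decreasing_by
  simp only [RTree.node.sizeOf_spec]
  have := List.sizeOf_lt_of_mem t.2
  omega

/-- The CFG2PDA transformation: given a grammar `G = (V, Σ, S, R)` (variables `N`,
terminals `T`, rules `R`, start variable `S`), the one-state PDA
`P = ({q}, Σ, Γ, δ, q, S)` with `Γ = V ∪ Σ ∪ {e}` for a fresh symbol `e` (encoded by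
`Option (N ⊕ T)` with `none = e`), where `δ` consists exactly of:
`(q, ε, X) ↪ (q, w)` for each rule `(X, w) ∈ R` with `w ≠ ε`;
`(q, ε, X) ↪ (q, e)` for each rule `(X, ε) ∈ R`;
`(q, b, b) ↪ (q, ε)` for each terminal `b`; and `(q, ε, e) ↪ (q, ε)`. -/
def cfg2pda {N T : Type} (R : Set (N × List (N ⊕ T))) (S : N) :
    PDA PUnit T (Option (N ⊕ T)) where
  q0 := PUnit.unit
  γ0 := some (Sum.inl S)
  δ := { act |
    (∃ (X : N) (w : List (N ⊕ T)), (X, w) ∈ R ∧ w ≠ [] ∧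
      act = (PUnit.unit, none, some (Sum.inl X), PUnit.unit, w.map some)) ∨
    (∃ X : N, (X, ([] : List (N ⊕ T))) ∈ R ∧
      act = (PUnit.unit, none, some (Sum.inl X), PUnit.unit, [none])) ∨
    (∃ b : T, act = (PUnit.unit, some b, some (Sum.inr b), PUnit.unit, [])) ∨
    act = (PUnit.unit, none, none, PUnit.unit, []) }

/-!
STATEMENT 11: Let `G = (V, Σ, S, R)` be a context-free grammar, let `P` be the PDA
obtained from `G` by the CFG2PDA transformation, and let `t` be a quasi-tree of `G`
with root labelled `X ∈ V ∪ Σ ∪ {ε}`. Then there exists a quasi-run `I ⊢* I′` of `P`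
such that `tape(I) = Y(t)` (the yield of `t`), `tape(I′) = ε`, and the initial stack
content of `I` is the single symbol `X` if `X ∈ V ∪ Σ`, and the fresh symbol `e` if
`X = ε` (in the encoding used here, the initial stack content is in both cases the
singleton consisting of the root label of `t`).
-/

theorem yieldQ_inl {N T : Type} (X : N) (ts : List (RTree (QLbl N T))) :
    yieldQ (.node (some (Sum.inl X)) ts) = (ts.map yieldQ).flatten := by
  rw [yieldQ.eq_def]
  simp

theorem yieldQ_none {N T : Type} : yieldQ (.node none [] : RTree (QLbl N T)) = [] := by
  rw [yieldQ.eq_def]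
  simp

/-- Moves that consume each tree of a forest in turn compose to moves consuming the forest. -/
theorem PDA.reflTransGen_move_forest {N T : Type} (P : PDA PUnit T (QLbl N T))
    (ts : List (RTree (QLbl N T)))
    (h : ∀ t ∈ ts, ∀ v rest, Relation.ReflTransGen P.Move
      ⟨PUnit.unit, yieldQ t ++ v, t.label :: rest⟩ ⟨PUnit.unit, v, rest⟩)
    (v : List T) (rest : List (QLbl N T)) :
    Relation.ReflTransGen P.Move
      ⟨PUnit.unit, (ts.map yieldQ).flatten ++ v, ts.map RTree.label ++ rest⟩
      ⟨PUnit.unit, v, rest⟩ := by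
  induction ts with
  | nil => exact .refl
  | cons t ts ih =>
    have hhead := h t (by simp) ((ts.map yieldQ).flatten ++ v) (ts.map RTree.label ++ rest)
    have htail := ih fun s hs => h s (List.mem_cons_of_mem _ hs)
    simpa using hhead.trans htail

/-- The PDA of a grammar pops the root label of a quasi-tree while reading its yield,
whatever follows on the tape and below on the stack. -/
theorem IsQuasiTree.reflTransGen_move {N T : Type} {R : Set (N × List (N ⊕ T))} (S : N)
    {t : RTree (QLbl N T)} (ht : IsQuasiTree R t) (v : List T) (rest : List (QLbl N T)) :
    Relation.ReflTransGen (cfg2pda R S).Move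
      ⟨PUnit.unit, yieldQ t ++ v, t.label :: rest⟩ ⟨PUnit.unit, v, rest⟩ := by
  have pop_none (v : List T) (rest : List (QLbl N T)) :
      (cfg2pda R S).Move ⟨PUnit.unit, v, none :: rest⟩ ⟨PUnit.unit, v, rest⟩ :=
    ⟨none, none, [], rest, Or.inr (Or.inr (Or.inr rfl)), rfl, rfl, rfl⟩
  induction ht generalizing v rest with
  | leafT b =>
    refine .single ⟨some b, some (Sum.inr b), [], rest,
      Or.inr (Or.inr (Or.inl ⟨b, rfl⟩)), rfl, rfl, ?_⟩
    simp [yieldQ]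
  | leafE =>
    rw [yieldQ_none]
    exact .single (pop_none v rest)
  | @nodeE X h =>
    have hy : yieldQ (.node (some (Sum.inl X)) [.node none []] : RTree (QLbl N T)) = [] := by
      simp [yieldQ_inl, yieldQ_none]
    rw [hy]
    exact .head ⟨none, some (Sum.inl X), [none], rest, Or.inr (Or.inl ⟨X, h, rfl⟩),
      rfl, rfl, rfl⟩ (.single (pop_none v rest))
  | @nodeR X ts w hne hrule hlab _ ih =>
    have hw : w ≠ [] := by
      rintro rfl
      simp_all
    rw [yieldQ_inl]
    exact .head ⟨none, some (Sum.inl X), w.map some, rest, Or.inl ⟨X, w, hrule, hw, rfl⟩,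
      rfl, congrArg (· ++ rest) hlab, rfl⟩
      ((cfg2pda R S).reflTransGen_move_forest ts ih v rest)

theorem cfg2pda_quasiRun {N T : Type} [Finite N] [Finite T]
    (R : Set (N × List (N ⊕ T))) (hR : R.Finite) (S : N)
    (t : RTree (QLbl N T)) (ht : IsQuasiTree R t) :
    ∃ r : List (ID PUnit T (Option (N ⊕ T))),
      (cfg2pda R S).IsQuasiRun r ∧
      (∃ I : ID PUnit T (Option (N ⊕ T)),
        r.head? = some I ∧ I.tape = yieldQ t ∧ I.stack = [t.label]) ∧
      (∃ I' : ID PUnit T (Option (N ⊕ T)), r.getLast? = some I' ∧ I'.tape = []) := by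
  obtain ⟨l, hl, hlast⟩ :=
    List.exists_isChain_cons_of_relationReflTransGen (ht.reflTransGen_move S [] [])
  have hlast' := (List.getLast?_eq_some_getLast (List.cons_ne_nil _ l)).trans (congrArg some hlast)
  exact ⟨_, ⟨hl, ⟨_, _, rfl, rfl⟩, _, hlast', rfl⟩, ⟨_, rfl, by simp, rfl⟩, _, hlast', rfl⟩
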